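/- arXiv:1711.00219 — 3 statements merged into one kernel-verified Lean document; each statement's English description precedes it below -/
import Mathlib

section
/- For all τ, η ∈ OP_n, the Goldberg coefficient satisfies: if τ̄ ≤ η̄ then g(τ,η) = ∫_{−1}^{0} x^{des_η(τ)} (1+x)^{asc_η(τ)} ∏_{j=1}^{r} Q_{q_j}(x) dx, where q_1,…,q_r are the lengths of the level runs of the sequence (m_1,…,m_s) associated to the pair (τ,η), and Q_q(x) = ∑ x^{k−1}/(n_1! n_2! ⋯ n_k!), the sum over all k ≥ 1 and all compositions (n_1,…,n_k) of q into positive integers (equivalently Q_q(x) = (1/q!) ∑_{k=1}^q k! S(q,k) x^{k−1} with S(q,k) the Stirling numbers of the second kind); and if τ̄ ≰ η̄ then g(τ,η) = 0. -/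
open Finset

namespace OSPpaper

/-- A *block* is a subset of `[n] = Fin n`. -/
abbrev Block (n : ℕ) := Finset (Fin n)

/-- `l` is an ordered set partition of the ground set `E ⊆ [n]`:
a finite sequence of pairwise disjoint nonempty subsets of `E` whose union is `E`. -/
def IsOSP {n : ℕ} (E : Finset (Fin n)) (l : List (Block n)) : Prop :=
  (∀ P ∈ l, P.Nonempty) ∧ l.Pairwise (fun P Q => Disjoint P Q) ∧
    (∀ P ∈ l, P ⊆ E) ∧ ∀ i ∈ E, ∃ P ∈ l, i ∈ P

/-- Union of a list of blocks. -/
def unionList {n : ℕ} (l : List (Block n)) : Block n := l.foldr (· ∪ ·) ∅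

/-- The order on ordered set partitions: `π ≤ σ` iff every block of `σ` is the union
of a contiguous run of blocks of `π` (runs taken in order). -/
def OSPle {n : ℕ} (π σ : List (Block n)) : Prop :=
  ∃ L : List (List (Block n)), L.flatten = π ∧ σ = L.map unionList

/-- The restriction `σ⌋_P`: intersect every block with `P` and delete the empty intersections. -/
def restrict {n : ℕ} (σ : List (Block n)) (P : Block n) : List (Block n) :=
  (σ.map (fun Q => Q ∩ P)).filter (fun Q => decide (Q ≠ ∅))

/-- The quasi-meet `π ⋏ σ`: the concatenation `σ⌋_{P₁} σ⌋_{P₂} ⋯ σ⌋_{P_p}`. -/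
def qmeet {n : ℕ} (π σ : List (Block n)) : List (Block n) :=
  (π.map (fun P => restrict σ P)).flatten

/-- Refinement: every block of `σ` is contained in some block of `τ`.
(As a relation on the underlying unordered partitions, this is the refinement order;
in particular `refines τ η` says `τ̄ ≤ η̄`.) -/
def refines {n : ℕ} (σ τ : List (Block n)) : Prop := ∀ P ∈ σ, ∃ Q ∈ τ, P ⊆ Q

/-- An interval partition of `[m]`, with its blocks listed in (the unique) increasing order:
an ordered set partition whose consecutive blocks are completely ordered. -/
def IsIP {m : ℕ} (l : List (Finset (Fin m))) : Prop :=
  IsOSP Finset.univ l ∧ l.Chain' (fun P Q => ∀ a ∈ P, ∀ b ∈ Q, a < b)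

/-- The (0-based) index `π(k)` of the block of `π` containing `k`. -/
def blockIdx {n : ℕ} (π : List (Block n)) (k : Fin n) : ℕ :=
  π.findIdx (fun P => decide (k ∈ P))

/-- The ordered kernel `κ(i₁,…,iₙ)` of a tuple: the nonempty level sets of the tuple,
listed in increasing order of the value. -/
def kernel {n : ℕ} (i : Fin n → ℕ) : List (Block n) :=
  ((Finset.image i Finset.univ).sort (· ≤ ·)).map
    (fun v => Finset.univ.filter (fun k => i k = v))

/-- `[σ:π] = ∏_{P ∈ π} #(σ⌋_P)`. -/
def colonNum {n : ℕ} (σ π : List (Block n)) : ℕ :=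
  (π.map (fun P => (restrict σ P).length)).prod

/-- `[σ:π]! = ∏_{P ∈ π} #(σ⌋_P)!`. -/
def colonFac {n : ℕ} (σ π : List (Block n)) : ℕ :=
  (π.map (fun P => Nat.factorial (restrict σ P).length)).prod

/-- For `τ̄ ≤ η̄` the sequence `(m_1,…,m_s)`: `m_i` is the (0-based) index of the block of `η`
containing the `i`-th block of `τ`. -/
def mseq {n : ℕ} (τ η : List (Block n)) : List ℕ :=
  τ.map (fun T => η.findIdx (fun E => decide (T ⊆ E)))

/-- number of ascents of a sequence -/
def ascL (l : List ℕ) : ℕ := ((l.zip l.tail).filter (fun p => decide (p.1 < p.2))).length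
/-- number of descents of a sequence -/
def desL (l : List ℕ) : ℕ := ((l.zip l.tail).filter (fun p => decide (p.2 < p.1))).length
/-- number of plateaux of a sequence -/
def platL (l : List ℕ) : ℕ := ((l.zip l.tail).filter (fun p => decide (p.1 = p.2))).length

/-- `asc_η(τ)` -/
def ascN {n : ℕ} (τ η : List (Block n)) : ℕ := ascL (mseq τ η)
/-- `des_η(τ)` -/
def desN {n : ℕ} (τ η : List (Block n)) : ℕ := desL (mseq τ η)
/-- `plat_η(τ)` -/
def platN {n : ℕ} (τ η : List (Block n)) : ℕ := platL (mseq τ η)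

/-- lengths of the maximal ascending runs of a sequence -/
def ascRunLengths (l : List ℕ) : List ℕ :=
  (l.splitBy (fun a b => decide (a < b))).map List.length
/-- lengths of the maximal level (constant) runs of a sequence -/
def levelRunLengths (l : List ℕ) : List ℕ :=
  (l.splitBy (fun a b => decide (a = b))).map List.length

/-- `μ̃(σ,π) = (−1)^{|σ|−|π|} / [σ:π]` (real-valued). -/
noncomputable def muR {n : ℕ} (σ π : List (Block n)) : ℝ :=
  (-1 : ℝ) ^ (σ.length - π.length) / (colonNum σ π : ℝ)

/-- `ζ̃(σ,π) = 1 / [σ:π]!` (real-valued). -/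
noncomputable def zetaR {n : ℕ} (σ π : List (Block n)) : ℝ :=
  1 / (colonFac σ π : ℝ)

/-- The Weisner coefficient `w(τ,η) = ∑_{σ ⋏ η = τ} μ̃(σ, 1̂ₙ)`. -/
noncomputable def wcoef {n : ℕ} (τ η : List (Block n)) : ℝ :=
  ∑ᶠ σ ∈ {σ : List (Block n) | IsOSP Finset.univ σ ∧ qmeet σ η = τ},
    muR σ [(Finset.univ : Block n)]

/-- The Goldberg coefficient `g(τ,η) = ∑_{σ ≥ τ} ζ̃(τ,σ) w(σ,η)`. -/
noncomputable def gcoef {n : ℕ} (τ η : List (Block n)) : ℝ :=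
  ∑ᶠ σ ∈ {σ : List (Block n) | IsOSP Finset.univ σ ∧ OSPle τ σ}, zetaR τ σ * wcoef σ η


/-- `Q_q(x) = ∑ x^{k−1}/(n₁!⋯n_k!)`, summed over all `k ≥ 1` and all compositions
`(n₁,…,n_k)` of `q` into positive integers — equivalently `(1/q!)∑_{k=1}^q k! S(q,k) x^{k−1}`,
the normalized homogeneous Eulerian polynomial. -/
noncomputable def Qpoly (q : ℕ) (x : ℝ) : ℝ :=
  ∑ c : Composition q, x ^ (c.length - 1) / ((c.blocks.map Nat.factorial).prod : ℝ)

section Cuts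

variable {α β : Type*}

/-- Prepend `a` to the first piece of a list of pieces. -/
def glue (a : α) : List (List α) → List (List α)
  | [] => [[a]]
  | B :: L => (a :: B) :: L

/-- All ways of cutting a list into nonempty contiguous pieces. -/
def cuts : List α → List (List (List α))
  | [] => [[]]
  | [a] => [[[a]]]
  | a :: b :: l => (cuts (b :: l)).map ([a] :: ·) ++ (cuts (b :: l)).map (glue a)

theorem mem_cuts {l : List α} {L : List (List α)} : L ∈ cuts l ↔ L.flatten = l ∧ [] ∉ L := by
  induction l using cuts.induct generalizing L with
  | case1 =>
    rcases L with _ | ⟨B, L⟩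
    · simp [cuts]
    · rcases B with _ | ⟨c, B⟩ <;> simp [cuts]
  | case2 a =>
    rcases L with _ | ⟨B, L⟩
    · simp [cuts]
    · rcases B with _ | ⟨c, B⟩
      · simp [cuts]
      · rcases L with _ | ⟨D, L⟩
        · simp [cuts]
        · rcases D with _ | ⟨d, D⟩ <;> simp [cuts]
  | case3 a b l ih =>
    rcases L with _ | ⟨B, L⟩
    · simp only [cuts, List.mem_append, List.mem_map, ih]
      constructor
      · rintro (⟨A, -, h⟩ | ⟨A, -, h⟩)
        · simp at h
        · cases A <;> simp [glue] at h
      · simp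
    · rcases B with _ | ⟨c, B⟩
      · simp only [cuts, List.mem_append, List.mem_map, ih]
        constructor
        · rintro (⟨A, -, h⟩ | ⟨A, -, h⟩)
          · simp at h
          · cases A <;> simp [glue] at h
        · simp
      · simp only [cuts, List.mem_append, List.mem_map, ih]
        constructor
        · rintro (⟨A, ⟨h1, h2⟩, h⟩ | ⟨A, ⟨h1, h2⟩, h⟩)
          · simp only [List.cons.injEq] at h
            obtain ⟨⟨rfl, rfl⟩, rfl⟩ := h
            simp [h1, h2]
          · rcases A with _ | ⟨D, A⟩
            · simp at h1
            · simp only [glue, List.cons.injEq] at h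
              obtain ⟨⟨rfl, rfl⟩, rfl⟩ := h
              simp only [List.mem_cons, not_or] at h2
              simp only [List.flatten_cons] at h1
              simp [h1, h2.2]
        · rintro ⟨h1, h2⟩
          simp only [List.flatten_cons, List.cons_append, List.cons.injEq] at h1
          simp only [List.mem_cons, not_or] at h2
          obtain ⟨rfl, h1⟩ := h1
          rcases B with _ | ⟨d, B⟩
          · exact Or.inl ⟨L, ⟨by simpa using h1, h2.2⟩, rfl⟩
          · exact Or.inr ⟨(d :: B) :: L, ⟨by simpa using h1, by simpa using h2.2⟩, rfl⟩

theorem exists_of_mem_cuts_cons {a : α} {l : List α} {L : List (List α)}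
    (h : L ∈ cuts (a :: l)) : ∃ B L', L = (a :: B) :: L' := by
  rw [mem_cuts] at h
  obtain ⟨h1, h2⟩ := h
  rcases L with _ | ⟨_ | ⟨c, B⟩, L⟩
  · simp at h1
  · simp at h2
  · simp only [List.flatten_cons, List.cons_append, List.cons.injEq] at h1
    exact ⟨B, L, by rw [h1.1]⟩

theorem nodup_cuts (l : List α) : (cuts l).Nodup := by
  induction l using cuts.induct with
  | case1 => simp [cuts]
  | case2 a => simp [cuts]
  | case3 a b l ih =>
    rw [cuts, List.nodup_append']
    refine ⟨ih.map fun _ _ h => List.tail_eq_of_cons_eq h, ih.map_on ?_, ?_⟩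
    · intro L hL M hM h
      obtain ⟨B, L', rfl⟩ := exists_of_mem_cuts_cons hL
      obtain ⟨C, M', rfl⟩ := exists_of_mem_cuts_cons hM
      simpa [glue] using h
    · intro L hL hM
      obtain ⟨L, hL, rfl⟩ := List.mem_map.1 hL
      obtain ⟨M, hM, h⟩ := List.mem_map.1 hM
      obtain ⟨C, M', rfl⟩ := exists_of_mem_cuts_cons hM
      simp [glue] at h

theorem map_glue (f : α → β) (a : α) (L : List (List α)) :
    (glue a L).map (List.map f) = glue (f a) (L.map (List.map f)) := by
  cases L <;> rfl

theorem cuts_map (f : α → β) (l : List α) :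
    cuts (l.map f) = (cuts l).map (List.map (List.map f)) := by
  induction l using cuts.induct with
  | case1 => simp [cuts]
  | case2 a => simp [cuts]
  | case3 a b l ih =>
    simp only [List.map_cons] at ih
    simp [cuts, ih, Function.comp_def, map_glue]

/-- The sum of `F` over all cuts of `l`. -/
def cutSum (F : List (List α) → ℝ) (l : List α) : ℝ := ((cuts l).map F).sum

theorem cutSum_congr {F G : List (List α) → ℝ} {l : List α} (h : ∀ L ∈ cuts l, F L = G L) :
    cutSum F l = cutSum G l := by
  rw [cutSum, cutSum, List.map_congr_left h]

theorem cutSum_eq_sum [DecidableEq α] (F : List (List α) → ℝ) (l : List α) :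
    cutSum F l = ∑ L ∈ (cuts l).toFinset, F L :=
  (List.sum_toFinset F (nodup_cuts l)).symm

theorem cutSum_map (f : α → β) (F : List (List β) → ℝ) (l : List α) :
    cutSum F (l.map f) = cutSum (fun L => F (L.map (List.map f))) l := by
  simp [cutSum, cuts_map, Function.comp_def]

theorem cutSum_mul_left (c : ℝ) (F : List (List α) → ℝ) (l : List α) :
    cutSum (fun L => c * F L) l = c * cutSum F l :=
  List.sum_map_mul_left ..

theorem cutSum_singleton (F : List (List α) → ℝ) (a : α) : cutSum F [a] = F [[a]] := by
  simp [cutSum, cuts]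

theorem cutSum_cons_cons (F : List (List α) → ℝ) (a b : α) (l : List α) :
    cutSum F (a :: b :: l) =
      cutSum (fun L => F ([a] :: L)) (b :: l) + cutSum (fun L => F (glue a L)) (b :: l) := by
  simp [cutSum, cuts, Function.comp_def]

theorem cutSum_eq_sum_composition (φ : ℕ → ℝ) (l : List α) :
    cutSum (fun L => (L.map fun B => φ B.length).prod) l =
      ∑ c : Composition l.length, (c.blocks.map φ).prod := by
  classical
  rw [cutSum_eq_sum]
  symm
  refine Finset.sum_bij (fun c _ => l.splitWrtComposition c) ?_ ?_ ?_ ?_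
  · intro c _
    rw [List.mem_toFinset, mem_cuts]
    exact ⟨l.flatten_splitWrtComposition c,
      fun h => absurd (List.length_pos_of_mem_splitWrtComposition h) (by simp)⟩
  · intro c _ d _ h
    apply Composition.ext
    rw [← List.map_length_splitWrtComposition l c, h, List.map_length_splitWrtComposition]
  · intro L hL
    rw [List.mem_toFinset, mem_cuts] at hL
    obtain ⟨rfl, h⟩ := hL
    refine ⟨⟨L.map List.length, ?_, by simp [List.length_flatten]⟩, mem_univ _,
      List.splitWrtComposition_flatten L _ rfl⟩
    intro i hi
    obtain ⟨B, hB, rfl⟩ := List.mem_map.1 hi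
    exact List.length_pos_iff.2 fun h' => h (h' ▸ hB)
  · intro c _
    rw [← List.map_length_splitWrtComposition l c, List.map_map]
    rfl

/-- Sum over the cuts of `l` of the product of the weights `f` of the pieces. -/
def blockSum (f : List α → ℝ) (l : List α) : ℝ := cutSum (fun L => (L.map f).prod) l

/-- Variant of `blockSum` in which the first piece is weighted by `g`. -/
def blockSumHead (g f : List α → ℝ) (l : List α) : ℝ :=
  cutSum (fun L => g (L.headD []) * (L.tail.map f).prod) l

theorem blockSum_cons (f : List α → ℝ) (a : α) (l : List α) :
    blockSum f (a :: l) = blockSumHead f f (a :: l) := by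
  refine cutSum_congr fun L hL => ?_
  obtain ⟨B, L', rfl⟩ := exists_of_mem_cuts_cons hL
  simp

theorem blockSumHead_cons_cons (g f : List α → ℝ) (a b : α) (l : List α) :
    blockSumHead g f (a :: b :: l) =
      g [a] * blockSum f (b :: l) + blockSumHead (fun B => g (a :: B)) f (b :: l) := by
  rw [blockSumHead, cutSum_cons_cons, blockSum, ← cutSum_mul_left]
  congr 1
  refine cutSum_congr fun L hL => ?_
  obtain ⟨B, L', rfl⟩ := exists_of_mem_cuts_cons hL
  simp [glue]

theorem blockSumHead_append (f : List α → ℝ) {u v : α} (hf : ∀ p q, f (p ++ u :: v :: q) = 0)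
    (l l' : List α) (g : List α → ℝ) (hg : ∀ p q, g (p ++ u :: v :: q) = 0) :
    blockSumHead g f (l ++ u :: v :: l') =
      blockSumHead g f (l ++ [u]) * blockSum f (v :: l') := by
  induction l generalizing g with
  | nil =>
    have h : blockSumHead (fun B => g (u :: B)) f (v :: l') = 0 := by
      rw [blockSumHead, cutSum_congr (G := fun _ => 0), cutSum]
      · simp
      · intro L hL
        obtain ⟨B, L', rfl⟩ := exists_of_mem_cuts_cons hL
        simpa using Or.inl (hg [] B)
    rw [List.nil_append, blockSumHead_cons_cons, h]
    simp [blockSumHead, cutSum_singleton]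
  | cons a l ih =>
    have h1 := ih f hf
    have h2 := ih (fun B => g (a :: B)) fun p q => hg (a :: p) q
    cases l with
    | nil =>
      simp only [List.nil_append, List.cons_append] at h1 h2 ⊢
      rw [blockSumHead_cons_cons g f a, h2, blockSum_cons f u, h1, blockSumHead_cons_cons g f a,
        blockSum_cons f u]
      ring
    | cons c l =>
      simp only [List.cons_append] at h1 h2 ⊢
      rw [blockSumHead_cons_cons g f a, h2, blockSum_cons f c, h1, blockSumHead_cons_cons g f a,
        blockSum_cons f c]
      ring

theorem blockSum_append (f : List α → ℝ) {u v : α} (hf : ∀ p q, f (p ++ u :: v :: q) = 0)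
    (l l' : List α) :
    blockSum f (l ++ u :: v :: l') = blockSum f (l ++ [u]) * blockSum f (v :: l') := by
  have h := blockSumHead_append f hf l l' f hf
  cases l <;> simpa only [List.nil_append, List.cons_append, ← blockSum_cons] using h

theorem blockSum_flatten (f : List α → ℝ)
    (hf : ∀ u v, u ≠ v → ∀ p q, f (p ++ u :: v :: q) = 0) (R : List (List α))
    (hR : R.IsChain fun a b => ∃ ha hb, a.getLast ha ≠ b.head hb) (hne : [] ∉ R) :
    blockSum f R.flatten = (R.map (blockSum f)).prod := by
  induction R with
  | nil => simp [blockSum, cutSum, cuts]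
  | cons B R ih =>
    have ih := ih hR.tail fun h => hne (List.mem_cons_of_mem _ h)
    rw [List.map_cons, List.prod_cons, ← ih]
    cases R with
    | nil => simp [blockSum, cutSum, cuts]
    | cons C R =>
      obtain ⟨hB, hC, h⟩ := (List.isChain_cons_cons.1 hR).1
      obtain ⟨v, C', rfl⟩ := List.exists_cons_of_ne_nil hC
      obtain ⟨l, u, rfl⟩ := List.eq_nil_or_concat' B |>.resolve_left hB
      have := blockSum_append f (hf u v (by simpa using h)) l (C' ++ R.flatten)
      simpa using this

end Cuts

section LevelRuns

theorem ascL_cons_cons (a b : ℕ) (l : List ℕ) :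
    ascL (a :: b :: l) = (if a < b then 1 else 0) + ascL (b :: l) := by
  by_cases h : a < b <;> simp [ascL, h, add_comm]

theorem desL_cons_cons (a b : ℕ) (l : List ℕ) :
    desL (a :: b :: l) = (if b < a then 1 else 0) + desL (b :: l) := by
  by_cases h : b < a <;> simp [desL, h, add_comm]

theorem platL_cons_cons (a b : ℕ) (l : List ℕ) :
    platL (a :: b :: l) = (if a = b then 1 else 0) + platL (b :: l) := by
  by_cases h : a = b <;> simp [platL, h, add_comm]

theorem ascL_singleton (a : ℕ) : ascL [a] = 0 := rfl

theorem desL_singleton (a : ℕ) : desL [a] = 0 := rfl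

theorem platL_singleton (a : ℕ) : platL [a] = 0 := rfl

theorem length_eq_asc_add_des_add_plat {l : List ℕ} (hl : l ≠ []) :
    l.length = ascL l + desL l + platL l + 1 := by
  induction l using cuts.induct with
  | case1 => exact absurd rfl hl
  | case2 a => rfl
  | case3 a b l ih =>
    have ih := ih (by simp)
    rw [List.length_cons, ih, ascL_cons_cons, desL_cons_cons, platL_cons_cons]
    grind

theorem ascL_append (l l' : List ℕ) (u v : ℕ) :
    ascL (l ++ u :: v :: l') = ascL (l ++ [u]) + (if u < v then 1 else 0) + ascL (v :: l') := by
  induction l with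
  | nil => simp [ascL_cons_cons, ascL_singleton]
  | cons a l ih =>
    cases l with
    | nil => simp [ascL_cons_cons, ascL_singleton, add_assoc]
    | cons b l =>
      simp only [List.cons_append] at ih ⊢
      rw [ascL_cons_cons a b, ascL_cons_cons a b, ih]
      ring

theorem desL_append (l l' : List ℕ) (u v : ℕ) :
    desL (l ++ u :: v :: l') = desL (l ++ [u]) + (if v < u then 1 else 0) + desL (v :: l') := by
  induction l with
  | nil => simp [desL_cons_cons, desL_singleton]
  | cons a l ih =>
    cases l with
    | nil => simp [desL_cons_cons, desL_singleton, add_assoc]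
    | cons b l =>
      simp only [List.cons_append] at ih ⊢
      rw [desL_cons_cons a b, desL_cons_cons a b, ih]
      ring

theorem asc_des_eq_zero_of_level {l : List ℕ} (h : l.IsChain (· = ·)) :
    ascL l = 0 ∧ desL l = 0 := by
  induction l using cuts.induct with
  | case1 => exact ⟨rfl, rfl⟩
  | case2 a => exact ⟨rfl, rfl⟩
  | case3 a b l ih =>
    obtain ⟨rfl, h⟩ := List.isChain_cons_cons.1 h
    simpa [ascL_cons_cons, desL_cons_cons] using ih h

theorem length_levelRuns (R : List (List ℕ)) (hne : [] ∉ R) (h0 : R ≠ [])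
    (hlev : ∀ B ∈ R, B.IsChain (· = ·))
    (hR : R.IsChain fun a b => ∃ ha hb, a.getLast ha ≠ b.head hb) :
    R.length = ascL R.flatten + desL R.flatten + 1 := by
  induction R with
  | nil => exact absurd rfl h0
  | cons B R ih =>
    obtain ⟨hBa, hBd⟩ := asc_des_eq_zero_of_level (hlev B (by simp))
    cases R with
    | nil => simp [hBa, hBd]
    | cons C R =>
      have ih := ih (fun h => hne (List.mem_cons_of_mem _ h)) (by simp)
        (fun D hD => hlev D (List.mem_cons_of_mem _ hD)) hR.tail
      obtain ⟨hB, hC, h⟩ := (List.isChain_cons_cons.1 hR).1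
      obtain ⟨v, C', rfl⟩ := List.exists_cons_of_ne_nil hC
      obtain ⟨l, u, rfl⟩ := List.eq_nil_or_concat' B |>.resolve_left hB
      have huv : u ≠ v := by simpa using h
      rw [List.length_cons, ih]
      have ha := ascL_append l (C' ++ R.flatten) u v
      have hd := desL_append l (C' ++ R.flatten) u v
      simp only [List.flatten_cons, List.append_assoc, List.cons_append, List.nil_append] at ha hd ⊢
      rw [ha, hd, hBa, hBd]
      grind

theorem cutSum_increasing (x : ℝ) {a : List ℕ} (ha : a ≠ []) :
    cutSum (fun A => if ∀ B ∈ A, B.IsChain (· < ·) then x ^ (A.length - 1) else 0) a =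
      x ^ (desL a + platL a) * (1 + x) ^ ascL a := by
  induction a using cuts.induct with
  | case1 => exact absurd rfl ha
  | case2 a => simp [cutSum_singleton, ascL_singleton, desL_singleton, platL_singleton]
  | case3 a b l ih =>
    have ih := ih (by simp)
    rw [cutSum_cons_cons, cutSum_congr (G := fun A => x *
        if ∀ B ∈ A, B.IsChain (· < ·) then x ^ (A.length - 1) else 0), cutSum_mul_left, ih,
      cutSum_congr (G := fun A => (if a < b then 1 else 0) *
        if ∀ B ∈ A, B.IsChain (· < ·) then x ^ (A.length - 1) else 0), cutSum_mul_left, ih,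
      ascL_cons_cons, desL_cons_cons, platL_cons_cons]
    · rcases lt_trichotomy a b with h | h | h
      · simp only [h, h.not_gt, h.ne, if_true, if_false, zero_add]
        ring
      · subst h
        simp only [lt_irrefl, if_true, if_false, zero_add]
        ring
      · simp only [h, h.not_gt, h.ne', if_true, if_false, zero_add]
        ring
    · intro A hA
      obtain ⟨B, A', rfl⟩ := exists_of_mem_cuts_cons hA
      by_cases h : a < b <;> simp [glue, h]
    · intro A hA
      obtain ⟨B, A', rfl⟩ := exists_of_mem_cuts_cons hA
      simp [pow_succ']

theorem asc_des_heads_of_level {a : List ℕ} {A : List (List ℕ)} (hA : A ∈ cuts a)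
    (hlev : ∀ B ∈ A, B.IsChain (· = ·)) :
    ascL (A.map (·.headD 0)) = ascL a ∧ desL (A.map (·.headD 0)) = desL a := by
  induction a using cuts.induct generalizing A with
  | case1 => simp_all [cuts]
  | case2 a => simp_all [cuts]
  | case3 a b l ih =>
    rw [cuts, List.mem_append, List.mem_map, List.mem_map] at hA
    rcases hA with ⟨A, hA, rfl⟩ | ⟨A, hA, rfl⟩
    · have ih := ih hA fun B hB => hlev B (List.mem_cons_of_mem _ hB)
      obtain ⟨B, A', rfl⟩ := exists_of_mem_cuts_cons hA
      simpa [ascL_cons_cons, desL_cons_cons] using ih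
    · obtain ⟨B, A', rfl⟩ := exists_of_mem_cuts_cons hA
      simp only [glue, List.forall_mem_cons, List.isChain_cons_cons] at hlev
      obtain ⟨⟨rfl, hB⟩, hA'⟩ := hlev
      have ih := ih hA (by simpa using ⟨hB, hA'⟩)
      simpa [glue, ascL_cons_cons, desL_cons_cons] using ih

theorem isChain_of_mem_cuts {α : Type*} {r : α → α → Prop} {l : List α} (h : l.IsChain r)
    {L : List (List α)} (hL : L ∈ cuts l) : ∀ B ∈ L, B.IsChain r := by
  intro B hB
  obtain ⟨rfl, hne⟩ := mem_cuts.1 hL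
  exact ((List.isChain_flatten hne).1 h).1 B hB

/-- The weight `x / |B|!` of a constant piece; other pieces have weight zero. -/
noncomputable def levelWeight (x : ℝ) (B : List ℕ) : ℝ :=
  if B.IsChain (· = ·) then x / (Nat.factorial B.length : ℝ) else 0

theorem levelWeight_of_level (x : ℝ) {B : List ℕ} (h : B.IsChain (· = ·)) :
    levelWeight x B = x / (Nat.factorial B.length : ℝ) :=
  if_pos h

theorem levelWeight_eq_zero (x : ℝ) {u v : ℕ} (h : u ≠ v) (p q : List ℕ) :
    levelWeight x (p ++ u :: v :: q) = 0 :=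
  if_neg fun hc => h (List.isChain_append_cons_cons.1 hc).2.1

theorem blockSum_levelWeight_of_level (x : ℝ) {a : List ℕ} (ha : a ≠ [])
    (h : a.IsChain (· = ·)) : blockSum (levelWeight x) a = x * Qpoly a.length x := by
  rw [blockSum, cutSum_congr
    (G := fun L => (L.map fun B => x / (Nat.factorial B.length : ℝ)).prod),
    cutSum_eq_sum_composition (fun k => x / (Nat.factorial k : ℝ)), Qpoly, Finset.mul_sum]
  · refine Finset.sum_congr rfl fun c _ => ?_
    have hc : 0 < c.length := c.length_pos_of_pos (List.length_pos_iff.2 ha)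
    have key : ∀ l : List ℕ, (l.map fun k => x / (Nat.factorial k : ℝ)).prod =
        x ^ l.length / ((l.map Nat.factorial).prod : ℝ) := by
      intro l
      induction l with
      | nil => simp
      | cons k l ih => simp [ih, pow_succ', div_mul_div_comm]
    obtain ⟨k, hk⟩ := Nat.exists_eq_add_of_lt hc
    rw [key, Composition.blocks_length, hk, zero_add, Nat.add_sub_cancel, pow_succ']
    ring
  · intro L hL
    rw [List.map_congr_left fun B hB => levelWeight_of_level x (isChain_of_mem_cuts h hL B hB)]

theorem blockSum_levelWeight (x : ℝ) {a : List ℕ} (ha : a ≠ []) :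
    blockSum (levelWeight x) a =
      x ^ (ascL a + desL a + 1) * ((levelRunLengths a).map fun q => Qpoly q x).prod := by
  set R := a.splitBy fun a b => decide (a = b) with hRdef
  have hR : R.IsChain fun a b => ∃ ha hb, a.getLast ha ≠ b.head hb := by
    simpa using List.isChain_getLast_head_splitBy (fun a b : ℕ => decide (a = b)) a
  have hlev : ∀ B ∈ R, B.IsChain (· = ·) := fun B hB => by
    simpa using List.isChain_of_mem_splitBy hB
  have hne : [] ∉ R := List.nil_notMem_splitBy _ _
  have hflat : R.flatten = a := List.flatten_splitBy _ _
  have hlen := length_levelRuns R hne (List.splitBy_ne_nil.2 ha) hlev hR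
  have hprod := blockSum_flatten (levelWeight x)
    (fun u v h p q => levelWeight_eq_zero x h p q) R hR hne
  rw [hflat] at hlen hprod
  rw [hprod, ← hlen, levelRunLengths, ← hRdef, List.map_map,
    List.map_congr_left fun B hB => blockSum_levelWeight_of_level x
      (fun h => hne (h ▸ hB)) (hlev B hB), List.prod_map_mul]
  simp [Function.comp_def]

theorem cutSum_level {x : ℝ} (hx : x ≠ 0) {a : List ℕ} (ha : a ≠ []) :
    cutSum (fun A => (1 / ((A.map fun B => Nat.factorial B.length).prod : ℝ)) *
        if ∀ B ∈ A, B.IsChain (· = ·) then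
          x ^ (desL (A.map (·.headD 0)) + platL (A.map (·.headD 0))) *
            (1 + x) ^ ascL (A.map (·.headD 0)) else 0) a =
      x ^ desL a * (1 + x) ^ ascL a *
        ((levelRunLengths a).map fun q => Qpoly q x).prod := by
  have hpow : x ^ (ascL a + desL a + 1) ≠ 0 := pow_ne_zero _ hx
  apply mul_left_cancel₀ hpow
  rw [mul_left_comm, ← blockSum_levelWeight x ha, blockSum, ← cutSum_mul_left, ← cutSum_mul_left]
  refine cutSum_congr fun A hA => ?_
  split_ifs with h
  · obtain ⟨h1, h2⟩ := asc_des_heads_of_level hA h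
    have hA0 : A ≠ [] := by
      rintro rfl
      exact ha (mem_cuts.1 hA).1.symm
    have hl := length_eq_asc_add_des_add_plat (l := A.map (·.headD 0)) (by simpa using hA0)
    rw [h1, h2, List.length_map] at hl
    have key : (A.map (levelWeight x)).prod =
        x ^ A.length / ((A.map fun B => Nat.factorial B.length).prod : ℝ) := by
      rw [List.map_congr_left fun B hB => levelWeight_of_level x (h B hB)]
      clear * -
      induction A with
      | nil => simp
      | cons k l ih => simp only [List.map_cons, List.prod_cons, ih, List.length_cons, pow_succ',
          Nat.cast_mul, div_mul_div_comm]
    rw [key, h1, h2, hl]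
    ring
  · push Not at h
    obtain ⟨B, hB, h⟩ := h
    have : (A.map (levelWeight x)).prod = 0 :=
      List.prod_eq_zero (List.mem_map.2 ⟨B, hB, if_neg h⟩)
    simp [this]

end LevelRuns

section SetPartitions

variable {n : ℕ}

theorem mem_unionList {l : List (Block n)} {i : Fin n} : i ∈ unionList l ↔ ∃ P ∈ l, i ∈ P := by
  induction l with
  | nil => simp [unionList]
  | cons P l ih =>
    rw [unionList, List.foldr_cons, Finset.mem_union, ← unionList, ih]
    simp

theorem subset_unionList {l : List (Block n)} {P : Block n} (h : P ∈ l) : P ⊆ unionList l :=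
  fun _ hi => mem_unionList.2 ⟨P, h, hi⟩

theorem unionList_subset {l : List (Block n)} {Q : Block n} :
    unionList l ⊆ Q ↔ ∀ P ∈ l, P ⊆ Q := by
  refine ⟨fun h P hP => (subset_unionList hP).trans h, fun h i hi => ?_⟩
  obtain ⟨P, hP, hi⟩ := mem_unionList.1 hi
  exact h P hP hi

theorem unionList_nonempty {l : List (Block n)} (h : ∀ P ∈ l, P.Nonempty) (hl : l ≠ []) :
    (unionList l).Nonempty := by
  obtain ⟨P, l', rfl⟩ := List.exists_cons_of_ne_nil hl
  exact (h P (by simp)).mono (subset_unionList (by simp))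

theorem restrict_cons_of_nonempty {Q P : Block n} (h : (Q ∩ P).Nonempty) (η : List (Block n)) :
    restrict (Q :: η) P = (Q ∩ P) :: restrict η P := by
  simp [restrict, h.ne_empty]

theorem restrict_cons_of_empty {Q P : Block n} (h : Q ∩ P = ∅) (η : List (Block n)) :
    restrict (Q :: η) P = restrict η P := by
  simp [restrict, h]

theorem mem_restrict {σ : List (Block n)} {P T : Block n} :
    T ∈ restrict σ P ↔ T.Nonempty ∧ ∃ Q ∈ σ, Q ∩ P = T := by
  simp [restrict, and_comm, Finset.nonempty_iff_ne_empty]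

theorem restrict_congr {σ : List (Block n)} {P P' : Block n}
    (h : ∀ Q ∈ σ, Q ∩ P = Q ∩ P') : restrict σ P = restrict σ P' := by
  rw [restrict, restrict, List.map_congr_left h]

theorem restrict_univ {σ : List (Block n)} (h : ∀ P ∈ σ, P.Nonempty) :
    restrict σ Finset.univ = σ := by
  simpa [restrict, List.filter_eq_self, Finset.nonempty_iff_ne_empty] using h

theorem unionList_restrict {η : List (Block n)} (hη : IsOSP Finset.univ η) (P : Block n) :
    unionList (restrict η P) = P := by
  ext i
  simp only [mem_unionList, mem_restrict]
  constructor
  · rintro ⟨T, ⟨-, Q, -, rfl⟩, hi⟩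
    exact (Finset.mem_inter.1 hi).2
  · intro hi
    obtain ⟨Q, hQ, hiQ⟩ := hη.2.2.2 i (Finset.mem_univ i)
    have : i ∈ Q ∩ P := Finset.mem_inter.2 ⟨hiQ, hi⟩
    exact ⟨Q ∩ P, ⟨⟨i, this⟩, Q, hQ, rfl⟩, this⟩

theorem restrict_sublistForall₂ (η : List (Block n)) (P : Block n) :
    List.SublistForall₂ (· ⊆ ·) (restrict η P) η := by
  induction η with
  | nil => exact .nil
  | cons Q η ih =>
    rcases (Q ∩ P).eq_empty_or_nonempty with h | h
    · rw [restrict_cons_of_empty h]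
      exact .cons_right ih
    · rw [restrict_cons_of_nonempty h]
      exact .cons Finset.inter_subset_left ih

theorem refines_of_sublistForall₂ {B η : List (Block n)}
    (h : List.SublistForall₂ (· ⊆ ·) B η) : refines B η := by
  induction h with
  | nil => simp [refines]
  | cons h _ ih =>
    intro P hP
    rcases List.mem_cons.1 hP with rfl | hP
    · exact ⟨_, List.mem_cons_self, h⟩
    · obtain ⟨Q, hQ, hPQ⟩ := ih P hP
      exact ⟨Q, List.mem_cons_of_mem _ hQ, hPQ⟩
  | cons_right _ ih =>
    intro P hP
    obtain ⟨Q, hQ, hPQ⟩ := ih P hP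
    exact ⟨Q, List.mem_cons_of_mem _ hQ, hPQ⟩

theorem disjoint_unionList {η B : List (Block n)} {Q : Block n}
    (hQ : ∀ E ∈ η, Disjoint Q E) (hB : refines B η) : Disjoint Q (unionList B) := by
  rw [Finset.disjoint_right]
  intro i hi
  obtain ⟨P, hP, hi⟩ := mem_unionList.1 hi
  obtain ⟨E, hE, hPE⟩ := hB P hP
  exact Finset.disjoint_right.1 (hQ E hE) (hPE hi)

theorem restrict_unionList {η B : List (Block n)} (hη : η.Pairwise fun P Q => Disjoint P Q)
    (hB : ∀ P ∈ B, P.Nonempty) (h : List.SublistForall₂ (· ⊆ ·) B η) :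
    restrict η (unionList B) = B := by
  induction h with
  | nil => simp [restrict, unionList]
  | @cons T Q B η hTQ h ih =>
    obtain ⟨hQ, hη⟩ := List.pairwise_cons.1 hη
    have hU : Q ∩ unionList (T :: B) = T := by
      change Q ∩ (T ∪ unionList B) = T
      rw [Finset.inter_union_distrib_left, Finset.inter_eq_right.2 hTQ,
        Finset.disjoint_iff_inter_eq_empty.1
          (disjoint_unionList hQ (refines_of_sublistForall₂ h)), Finset.union_empty]
    rw [restrict_cons_of_nonempty (by rw [hU]; exact hB T (by simp)), hU]
    congr 1
    rw [← restrict_congr (P := unionList B), ih hη fun P hP => hB P (by simp [hP])]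
    intro E hE
    change E ∩ unionList B = E ∩ (T ∪ unionList B)
    rw [Finset.inter_union_distrib_left, Finset.disjoint_iff_inter_eq_empty.1
      ((hQ E hE).symm.mono_right hTQ), Finset.empty_union]
  | @cons_right Q B η h ih =>
    obtain ⟨hQ, hη⟩ := List.pairwise_cons.1 hη
    rw [restrict_cons_of_empty, ih hη hB]
    exact Finset.disjoint_iff_inter_eq_empty.1
      (disjoint_unionList hQ (refines_of_sublistForall₂ h))

/-- The index of the block of `η` containing `T`. -/
def blockPos (η : List (Block n)) (T : Block n) : ℕ := η.findIdx fun E => decide (T ⊆ E)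

theorem mseq_eq_map (τ η : List (Block n)) : mseq τ η = τ.map (blockPos η) := rfl

theorem blockPos_cons_of_subset {Q T : Block n} (h : T ⊆ Q) (η : List (Block n)) :
    blockPos (Q :: η) T = 0 := by
  simp [blockPos, List.findIdx_cons, h]

theorem blockPos_cons_of_not_subset {Q T : Block n} (h : ¬ T ⊆ Q) (η : List (Block n)) :
    blockPos (Q :: η) T = blockPos η T + 1 := by
  simp [blockPos, List.findIdx_cons, h]

theorem sublistForall₂_iff_pairwise {η B : List (Block n)}
    (hη : η.Pairwise fun P Q => Disjoint P Q) (hB : ∀ P ∈ B, P.Nonempty) (h : refines B η) :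
    List.SublistForall₂ (· ⊆ ·) B η ↔ B.Pairwise fun S T => blockPos η S < blockPos η T := by
  constructor
  · intro h
    clear * - h hη hB
    induction h with
    | nil => exact .nil
    | @cons T Q B η hTQ h ih =>
      obtain ⟨hQ, hη⟩ := List.pairwise_cons.1 hη
      have hB' : ∀ P ∈ B, P.Nonempty := fun P hP => hB P (by simp [hP])
      have hns : ∀ S ∈ B, ¬ S ⊆ Q := by
        intro S hS hSQ
        obtain ⟨E, hE, hSE⟩ := refines_of_sublistForall₂ h S hS
        obtain ⟨i, hi⟩ := hB' S hS
        exact Finset.disjoint_left.1 (hQ E hE) (hSQ hi) (hSE hi)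
      refine List.pairwise_cons.2 ⟨fun S hS => ?_, (ih hη hB').imp_of_mem ?_⟩
      · rw [blockPos_cons_of_subset hTQ, blockPos_cons_of_not_subset (hns S hS)]
        omega
      · intro S S' hS hS' hlt
        rw [blockPos_cons_of_not_subset (hns S hS), blockPos_cons_of_not_subset (hns S' hS')]
        omega
    | @cons_right Q B η h ih =>
      obtain ⟨hQ, hη⟩ := List.pairwise_cons.1 hη
      have hns : ∀ S ∈ B, ¬ S ⊆ Q := by
        intro S hS hSQ
        obtain ⟨E, hE, hSE⟩ := refines_of_sublistForall₂ h S hS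
        obtain ⟨i, hi⟩ := hB S hS
        exact Finset.disjoint_left.1 (hQ E hE) (hSQ hi) (hSE hi)
      refine (ih hη hB).imp_of_mem ?_
      intro S S' hS hS' hlt
      rw [blockPos_cons_of_not_subset (hns S hS), blockPos_cons_of_not_subset (hns S' hS')]
      omega
  · intro hpos
    clear hη hB
    induction η generalizing B with
    | nil =>
      cases B with
      | nil => exact .nil
      | cons T B =>
        obtain ⟨E, hE, -⟩ := h T (by simp)
        simp at hE
    | cons Q η ih =>
      have tail : ∀ C : List (Block n), C.Pairwise (fun S T =>
          blockPos (Q :: η) S < blockPos (Q :: η) T) → refines C (Q :: η) →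
          (∀ S ∈ C, ¬ S ⊆ Q) → List.SublistForall₂ (· ⊆ ·) C η := by
        intro C hC href hns
        refine ih ?_ (hC.imp_of_mem ?_)
        · intro S hS
          obtain ⟨E, hE, hSE⟩ := href S hS
          rcases List.mem_cons.1 hE with rfl | hE
          · exact absurd hSE (hns S hS)
          · exact ⟨E, hE, hSE⟩
        · intro S S' hS hS' hlt
          rw [blockPos_cons_of_not_subset (hns S hS),
            blockPos_cons_of_not_subset (hns S' hS')] at hlt
          omega
      cases B with
      | nil => exact .nil
      | cons T B =>
        obtain ⟨hT, hB⟩ := List.pairwise_cons.1 hpos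
        have hns : ∀ S ∈ B, ¬ S ⊆ Q := by
          intro S hS hSQ
          have := hT S hS
          rw [blockPos_cons_of_subset hSQ] at this
          omega
        by_cases hTQ : T ⊆ Q
        · exact .cons hTQ (tail B hB (fun S hS => h S (by simp [hS])) hns)
        · exact .cons_right (tail _ hpos h (List.forall_mem_cons.2 ⟨hTQ, hns⟩))

theorem blockPos_eq_of_subset {η : List (Block n)} (hη : η.Pairwise fun P Q => Disjoint P Q)
    {T U Q : Block n} (hT : T.Nonempty) (hTU : T ⊆ U) (hQ : Q ∈ η) (hUQ : U ⊆ Q) :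
    blockPos η T = blockPos η U := by
  induction η with
  | nil => simp at hQ
  | cons E η ih =>
    obtain ⟨hE, hη⟩ := List.pairwise_cons.1 hη
    rcases List.mem_cons.1 hQ with rfl | hQ
    · rw [blockPos_cons_of_subset hUQ, blockPos_cons_of_subset (hTU.trans hUQ)]
    · have hTE : ¬ T ⊆ E := by
        intro h
        obtain ⟨i, hi⟩ := hT
        exact Finset.disjoint_left.1 (hE Q hQ) (h hi) (hUQ (hTU hi))
      rw [blockPos_cons_of_not_subset hTE, blockPos_cons_of_not_subset fun h => hTE (hTU.trans h),
        ih hη hQ]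

theorem subset_getElem_of_blockPos_eq {η : List (Block n)} {T : Block n} {i : ℕ}
    (hi : i < η.length) (h : blockPos η T = i) : T ⊆ η[i] := by
  subst h
  exact of_decide_eq_true (List.findIdx_getElem (p := fun E => decide (T ⊆ E)) (w := hi))

theorem blockPos_lt_length {η : List (Block n)} {T : Block n} (hT : ∃ Q ∈ η, T ⊆ Q) :
    blockPos η T < η.length := by
  obtain ⟨Q, hQ, hTQ⟩ := hT
  exact List.findIdx_lt_length_of_exists ⟨Q, hQ, by simpa using hTQ⟩

theorem level_iff_exists_superset {η B : List (Block n)}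
    (hη : η.Pairwise fun P Q => Disjoint P Q) (hB : ∀ P ∈ B, P.Nonempty) (hB0 : B ≠ [])
    (h : refines B η) :
    (B.map (blockPos η)).IsChain (· = ·) ↔ ∃ Q ∈ η, unionList B ⊆ Q := by
  constructor
  · intro hc
    obtain ⟨T, B, rfl⟩ := List.exists_cons_of_ne_nil hB0
    rw [List.isChain_iff_pairwise, List.map_cons, List.pairwise_cons] at hc
    have hlt := blockPos_lt_length (h T (by simp))
    refine ⟨η[blockPos η T], List.getElem_mem _, unionList_subset.2 ?_⟩
    intro P hP
    rcases List.mem_cons.1 hP with rfl | hP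
    · exact subset_getElem_of_blockPos_eq hlt rfl
    · exact subset_getElem_of_blockPos_eq hlt (hc.1 _ (List.mem_map_of_mem hP)).symm
  · rintro ⟨Q, hQ, hBQ⟩
    refine List.Pairwise.isChain (List.pairwise_map.2 (List.pairwise_of_forall_mem_list ?_))
    intro S hS T hT
    rw [blockPos_eq_of_subset hη (hB S hS) (subset_unionList hS) hQ hBQ,
      blockPos_eq_of_subset hη (hB T hT) (subset_unionList hT) hQ hBQ]

theorem blockPos_unionList {η B : List (Block n)}
    (hη : η.Pairwise fun P Q => Disjoint P Q) (hB : ∀ P ∈ B, P.Nonempty) (hB0 : B ≠ [])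
    (h : ∃ Q ∈ η, unionList B ⊆ Q) :
    blockPos η (unionList B) = (B.map (blockPos η)).headD 0 := by
  obtain ⟨Q, hQ, hBQ⟩ := h
  obtain ⟨T, B, rfl⟩ := List.exists_cons_of_ne_nil hB0
  exact (blockPos_eq_of_subset hη (hB T (by simp)) (subset_unionList (by simp)) hQ hBQ).symm

theorem isOSP_map_unionList {τ : List (Block n)} (hτ : IsOSP Finset.univ τ)
    {L : List (List (Block n))} (hL : L ∈ cuts τ) :
    IsOSP Finset.univ (L.map unionList) := by
  obtain ⟨rfl, hne⟩ := mem_cuts.1 hL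
  obtain ⟨h1, h2, -, h4⟩ := hτ
  refine ⟨?_, ?_, fun _ _ => Finset.subset_univ _, ?_⟩
  · intro P hP
    obtain ⟨B, hB, rfl⟩ := List.mem_map.1 hP
    exact unionList_nonempty (fun P hP => h1 P (List.mem_flatten_of_mem hB hP))
      fun h => hne (h ▸ hB)
  · rw [List.pairwise_flatten] at h2
    refine List.pairwise_map.2 (h2.2.imp fun {B C} h => Finset.disjoint_left.2 fun i hi hi' => ?_)
    obtain ⟨P, hP, hi⟩ := mem_unionList.1 hi
    obtain ⟨Q, hQ, hi'⟩ := mem_unionList.1 hi'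
    exact Finset.disjoint_left.1 (h P hP Q hQ) hi hi'
  · intro i hi
    obtain ⟨P, hP, hiP⟩ := h4 i hi
    obtain ⟨B, hB, hPB⟩ := List.mem_flatten.1 hP
    exact ⟨unionList B, List.mem_map_of_mem hB, mem_unionList.2 ⟨P, hPB, hiP⟩⟩

theorem restrict_of_mem_cut {τ : List (Block n)} (hτ : IsOSP Finset.univ τ)
    {L : List (List (Block n))} (hL : L ∈ cuts τ) {B : List (Block n)} (hB : B ∈ L) :
    restrict τ (unionList B) = B := by
  obtain ⟨rfl, -⟩ := mem_cuts.1 hL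
  exact restrict_unionList hτ.2.1 (fun P hP => hτ.1 P (List.mem_flatten_of_mem hB hP))
    (List.infix_of_mem_flatten hB).sublist.sublistForall₂

theorem injOn_map_unionList {τ : List (Block n)} (hτ : IsOSP Finset.univ τ) :
    Set.InjOn (List.map (unionList (n := n))) {L | L ∈ cuts τ} := by
  refine Set.LeftInvOn.injOn (f₁' := List.map (restrict τ)) fun L hL => ?_
  rw [List.map_map]
  conv_rhs => rw [← List.map_id L]
  exact List.map_congr_left fun B hB => restrict_of_mem_cut hτ hL hB

theorem coarsenings_eq_image {τ : List (Block n)} (hτ : IsOSP Finset.univ τ) :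
    {σ : List (Block n) | IsOSP Finset.univ σ ∧ OSPle τ σ} =
      List.map unionList '' {L | L ∈ cuts τ} := by
  ext σ
  constructor
  · rintro ⟨hσ, L, hL, rfl⟩
    refine ⟨L, mem_cuts.2 ⟨hL, fun h => ?_⟩, rfl⟩
    have := hσ.1 (unionList []) (List.mem_map_of_mem h)
    simp [unionList] at this
  · rintro ⟨L, hL, rfl⟩
    exact ⟨isOSP_map_unionList hτ hL, L, (mem_cuts.1 hL).1, rfl⟩

theorem refines_of_qmeet {σ η τ : List (Block n)} (h : qmeet σ η = τ) : refines τ η := by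
  rintro T hT
  rw [← h, qmeet, List.mem_flatten] at hT
  obtain ⟨l, hl, hT⟩ := hT
  obtain ⟨P, -, rfl⟩ := List.mem_map.1 hl
  obtain ⟨-, Q, hQ, rfl⟩ := mem_restrict.1 hT
  exact ⟨Q, hQ, Finset.inter_subset_left⟩

theorem qmeet_fiber_eq_image {τ η : List (Block n)} (hτ : IsOSP Finset.univ τ)
    (hη : IsOSP Finset.univ η) (h : refines τ η) :
    {σ : List (Block n) | IsOSP Finset.univ σ ∧ qmeet σ η = τ} =
      List.map unionList ''
        {L | L ∈ cuts τ ∧ ∀ B ∈ L, (B.map (blockPos η)).IsChain (· < ·)} := by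
  have chain_iff : ∀ B : List (Block n), (∀ P ∈ B, P ∈ τ) →
      ((B.map (blockPos η)).IsChain (· < ·) ↔ List.SublistForall₂ (· ⊆ ·) B η) := by
    intro B hB
    rw [sublistForall₂_iff_pairwise hη.2.1 (fun P hP => hτ.1 P (hB P hP))
      (fun P hP => h P (hB P hP)), List.isChain_iff_pairwise, List.pairwise_map]
  ext σ
  constructor
  · rintro ⟨hσ, hq⟩
    refine ⟨σ.map (restrict η), ⟨mem_cuts.2 ⟨hq, fun h0 => ?_⟩, fun B hB => ?_⟩, ?_⟩
    · obtain ⟨P, hP, hP0⟩ := List.mem_map.1 h0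
      have := unionList_restrict hη P
      rw [hP0] at this
      exact (hσ.1 P hP).ne_empty this.symm
    · rw [chain_iff B fun P hP => hq ▸ List.mem_flatten_of_mem hB hP]
      obtain ⟨P, -, rfl⟩ := List.mem_map.1 hB
      exact restrict_sublistForall₂ η P
    · rw [List.map_map]
      conv_rhs => rw [← List.map_id σ]
      exact List.map_congr_left fun P _ => unionList_restrict hη P
  · rintro ⟨L, ⟨hL, hinc⟩, rfl⟩
    refine ⟨isOSP_map_unionList hτ hL, ?_⟩
    have hmem : ∀ B ∈ L, ∀ P ∈ B, P ∈ τ := fun B hB P hP =>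
      (mem_cuts.1 hL).1 ▸ List.mem_flatten_of_mem hB hP
    rw [qmeet, List.map_map, ← (mem_cuts.1 hL).1]
    congr 1
    conv_rhs => rw [← List.map_id L]
    exact List.map_congr_left fun B hB => restrict_unionList hη.2.1
      (fun P hP => hτ.1 P (hmem B hB P hP)) ((chain_iff B (hmem B hB)).1 (hinc B hB))

theorem wcoef_eq_zero {τ η : List (Block n)} (h : ¬ refines τ η) : wcoef τ η = 0 := by
  have : {σ : List (Block n) | IsOSP Finset.univ σ ∧ qmeet σ η = τ} = ∅ :=
    Set.eq_empty_of_forall_notMem fun σ hσ => h (refines_of_qmeet hσ.2)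
  rw [wcoef, this, finsum_mem_empty]

theorem wcoef_eq_cutSum {τ η : List (Block n)} (hτ : IsOSP Finset.univ τ)
    (hη : IsOSP Finset.univ η) (h : refines τ η) :
    wcoef τ η = cutSum (fun A => if ∀ B ∈ A, B.IsChain (· < ·) then
      (-1 : ℝ) ^ (A.length - 1) / A.length else 0) (mseq τ η) := by
  have hset : {L | L ∈ cuts τ ∧ ∀ B ∈ L, (B.map (blockPos η)).IsChain (· < ·)} =
      (((cuts τ).toFinset.filter fun L => ∀ B ∈ L, (B.map (blockPos η)).IsChain (· < ·) :
        Finset (List (List (Block n)))) : Set (List (List (Block n)))) := by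
    ext L
    simp
  rw [wcoef, qmeet_fiber_eq_image hτ hη h,
    finsum_mem_image ((injOn_map_unionList hτ).mono fun L hL => hL.1), hset,
    finsum_mem_coe_finset, Finset.sum_filter, mseq_eq_map, cutSum_map, cutSum_eq_sum]
  refine Finset.sum_congr rfl fun L hL => ?_
  have hO := isOSP_map_unionList hτ (List.mem_toFinset.1 hL)
  simp [muR, colonNum, restrict_univ hO.1]

theorem integral_pow_pred {k : ℕ} (hk : k ≠ 0) :
    ∫ x in (-1 : ℝ)..0, x ^ (k - 1) = (-1) ^ (k - 1) / k := by
  obtain ⟨k, rfl⟩ := Nat.exists_eq_succ_of_ne_zero hk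
  rw [integral_pow]
  simp [pow_succ]

theorem wcoef_eq_integral {τ η : List (Block n)} (hτ : IsOSP Finset.univ τ)
    (hη : IsOSP Finset.univ η) (h : refines τ η) (h0 : τ ≠ []) :
    wcoef τ η = ∫ x in (-1 : ℝ)..0,
      x ^ (desL (mseq τ η) + platL (mseq τ η)) * (1 + x) ^ ascL (mseq τ η) := by
  have ha : mseq τ η ≠ [] := by simpa [mseq] using h0
  simp only [← cutSum_increasing _ ha]
  simp only [cutSum_eq_sum]
  rw [intervalIntegral.integral_finsetSum, wcoef_eq_cutSum hτ hη h, cutSum_eq_sum]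
  · refine Finset.sum_congr rfl fun A hA => ?_
    have hA0 : A.length ≠ 0 := by
      rw [Ne, List.length_eq_zero_iff]
      rintro rfl
      exact ha (mem_cuts.1 (List.mem_toFinset.1 hA)).1.symm
    split_ifs
    · rw [integral_pow_pred hA0]
    · simp
  · intro A _
    split_ifs
    · exact (continuous_pow _).intervalIntegrable _ _
    · exact intervalIntegrable_const

theorem gcoef_eq_cutSum {τ : List (Block n)} (hτ : IsOSP Finset.univ τ) (η : List (Block n)) :
    gcoef τ η = cutSum (fun L => (1 / ((L.map fun B => Nat.factorial B.length).prod : ℝ)) *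
      wcoef (L.map unionList) η) τ := by
  have hset : {L | L ∈ cuts τ} =
      ((cuts τ).toFinset : Set (List (List (Block n)))) := by
    ext L
    simp
  rw [gcoef, coarsenings_eq_image hτ, finsum_mem_image (injOn_map_unionList hτ), hset,
    finsum_mem_coe_finset, cutSum_eq_sum]
  refine Finset.sum_congr rfl fun L hL => ?_
  rw [zetaR, colonFac, List.map_map, List.map_congr_left fun B hB => by
    rw [Function.comp_apply, restrict_of_mem_cut hτ (List.mem_toFinset.1 hL) hB]]

theorem refines_map_unionList_iff {τ η : List (Block n)} (hτ : IsOSP Finset.univ τ)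
    (hη : IsOSP Finset.univ η) (h : refines τ η) {L : List (List (Block n))} (hL : L ∈ cuts τ) :
    refines (L.map unionList) η ↔ ∀ B ∈ L, (B.map (blockPos η)).IsChain (· = ·) := by
  obtain ⟨rfl, hne⟩ := mem_cuts.1 hL
  rw [refines, List.forall_mem_map]
  refine forall₂_congr fun B hB => (level_iff_exists_superset hη.2.1
    (fun P hP => hτ.1 P (List.mem_flatten_of_mem hB hP)) (fun h => hne (h ▸ hB))
    fun P hP => h P (List.mem_flatten_of_mem hB hP)).symm

theorem mseq_map_unionList {τ η : List (Block n)} (hτ : IsOSP Finset.univ τ)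
    (hη : IsOSP Finset.univ η) {L : List (List (Block n))} (hL : L ∈ cuts τ)
    (href : refines (L.map unionList) η) :
    mseq (L.map unionList) η = (L.map (List.map (blockPos η))).map (·.headD 0) := by
  obtain ⟨rfl, hne⟩ := mem_cuts.1 hL
  rw [mseq_eq_map, List.map_map, List.map_map]
  exact List.map_congr_left fun B hB => blockPos_unionList hη.2.1
    (fun P hP => hτ.1 P (List.mem_flatten_of_mem hB hP)) (fun h => hne (h ▸ hB))
    (href _ (List.mem_map_of_mem hB))

theorem gcoef_eq_integral {τ η : List (Block n)} (hτ : IsOSP Finset.univ τ)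
    (hη : IsOSP Finset.univ η) (h : refines τ η) (h0 : τ ≠ []) :
    gcoef τ η = ∫ x in (-1 : ℝ)..0, x ^ desN τ η * (1 + x) ^ ascN τ η *
      ((levelRunLengths (mseq τ η)).map (fun q => Qpoly q x)).prod := by
  have ha : mseq τ η ≠ [] := by simpa [mseq] using h0
  rw [desN, ascN, intervalIntegral.integral_congr_Ioo_of_le (by norm_num)
    fun x hx => (cutSum_level hx.2.ne ha).symm]
  simp only [mseq_eq_map τ, cutSum_map]
  simp only [cutSum_eq_sum]
  rw [gcoef_eq_cutSum hτ, cutSum_eq_sum, intervalIntegral.integral_finsetSum]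
  · refine Finset.sum_congr rfl fun L hL => ?_
    replace hL := List.mem_toFinset.1 hL
    have hL0 : L.map unionList ≠ [] := by
      rw [Ne, List.map_eq_nil_iff]
      rintro rfl
      exact h0 (mem_cuts.1 hL).1.symm
    have hiff := refines_map_unionList_iff hτ hη h hL
    rw [← List.forall_mem_map (P := List.IsChain (· = ·))] at hiff
    rw [intervalIntegral.integral_const_mul]
    congr 1
    · simp [Function.comp_def]
    · by_cases href : refines (L.map unionList) η
      · simp only [if_pos (hiff.1 href)]
        rw [wcoef_eq_integral (isOSP_map_unionList hτ hL) hη href hL0,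
          mseq_map_unionList hτ hη hL href]
      · simp only [if_neg (mt hiff.2 href)]
        rw [wcoef_eq_zero href, intervalIntegral.integral_zero]
  · intro L _
    refine Continuous.intervalIntegrable ?_ _ _
    split_ifs <;> fun_prop

theorem gcoef_eq_zero {τ η : List (Block n)} (hτ : IsOSP Finset.univ τ)
    (h : ¬ refines τ η) : gcoef τ η = 0 := by
  rw [gcoef_eq_cutSum hτ, cutSum_congr (G := fun _ => 0)]
  · simp [cutSum]
  · intro L hL
    rw [wcoef_eq_zero, mul_zero]
    intro href
    refine h fun T hT => ?_
    rw [← (mem_cuts.1 hL).1, List.mem_flatten] at hT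
    obtain ⟨B, hB, hT⟩ := hT
    obtain ⟨Q, hQ, hBQ⟩ := href _ (List.mem_map_of_mem hB)
    exact ⟨Q, hQ, (subset_unionList hT).trans hBQ⟩

end SetPartitions

/-- For all `τ, η ∈ OP_n` (`n ≥ 1`): if `τ̄ ≤ η̄` then
`g(τ,η) = ∫_{−1}^0 x^{des_η(τ)} (1+x)^{asc_η(τ)} ∏_{j=1}^r Q_{q_j}(x) dx`, where `q₁,…,q_r` are
the lengths of the level runs of the sequence `(m₁,…,m_s)` associated to `(τ,η)`;
and if `τ̄ ≰ η̄` then `g(τ,η) = 0`. -/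
theorem statement15 {n : ℕ} (hn : 1 ≤ n) (τ η : List (Block n))
    (hτ : IsOSP Finset.univ τ) (hη : IsOSP Finset.univ η) :
    (refines τ η →
      gcoef τ η = ∫ x in (-1 : ℝ)..0,
        x ^ desN τ η * (1 + x) ^ ascN τ η *
          ((levelRunLengths (mseq τ η)).map (fun q => Qpoly q x)).prod) ∧
    (¬ refines τ η → gcoef τ η = 0) := by
  have h0 : τ ≠ [] := by
    rintro rfl
    obtain ⟨P, hP, -⟩ := hτ.2.2.2 ⟨0, hn⟩ (Finset.mem_univ _)
    simp at hP
  exact ⟨fun h => gcoef_eq_integral hτ hη h h0, gcoef_eq_zero hτ⟩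

end OSPpaper
end

section
/- Let A be a unital associative ℚ-algebra, let n ≥ 2, let X_1,…,X_n ∈ A, and suppose there is a subset I ⊆ [n] with ∅ ≠ I ≠ [n] such that X_i X_j = X_j X_i for all i ∈ I and j ∈ [n]∖I. Then ∑_{π ∈ OP_n} ((−1)^{|π|−1}/|π|) · X_{P_1} X_{P_2} ⋯ X_{P_{|π|}} = 0, where for π = (P_1,…,P_{|π|}) and P ⊆ [n], X_P denotes the product of the X_k with k ∈ P taken in increasing order of k. (In other words, the noncommutative-tensor cumulant K_n^{NCT}(X_1,…,X_n), which is a Lie element, vanishes whenever the arguments split into two mutually commuting families.) -/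
open Finset

namespace OSPpaper

/-- The ordered product `X_P = X_{p₁} X_{p₂} ⋯ X_{p_k}` for `P = {p₁ < p₂ < ⋯ < p_k}`. -/
def blockProd {n : ℕ} {A : Type*} [Monoid A] (X : Fin n → A) (P : Block n) : A :=
  ((P.sort (· ≤ ·)).map X).prod

open Polynomial in
/-- The polynomial `x(x-1)⋯(x-k+1)/k!`. -/
noncomputable def binomPoly (k : ℕ) : ℚ[X] :=
  C ((k.factorial : ℚ)⁻¹) * descPochhammer ℚ k

theorem binomPoly_eval_natCast (k N : ℕ) :
    (binomPoly k).eval (N : ℚ) = (N.choose k : ℚ) := by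
  have h : (k.factorial : ℚ) ≠ 0 := by exact_mod_cast k.factorial_ne_zero
  rw [binomPoly, Polynomial.eval_mul, Polynomial.eval_C, descPochhammer_eval_eq_descFactorial,
    Nat.descFactorial_eq_factorial_mul_choose]
  push_cast
  field_simp

theorem descPochhammer_succ_coeff_zero (k : ℕ) : (descPochhammer ℚ (k + 1)).coeff 0 = 0 := by
  rw [descPochhammer_succ_left, Polynomial.mul_coeff_zero, Polynomial.coeff_X_zero, zero_mul]

theorem descPochhammer_succ_coeff_one (k : ℕ) :
    (descPochhammer ℚ (k + 1)).coeff 1 = (-1) ^ k * k.factorial := by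
  induction k with
  | zero => simp
  | succ k ih =>
    rw [descPochhammer_succ_right, mul_sub, Polynomial.coeff_sub, Polynomial.coeff_mul_X,
      descPochhammer_succ_coeff_zero, ← Polynomial.C_eq_natCast, Polynomial.coeff_mul_C, ih,
      Nat.factorial_succ]
    push_cast
    ring

theorem binomPoly_coeff_zero {k : ℕ} (hk : k ≠ 0) : (binomPoly k).coeff 0 = 0 := by
  obtain ⟨k, rfl⟩ := Nat.exists_eq_succ_of_ne_zero hk
  rw [binomPoly, Polynomial.coeff_C_mul, Nat.succ_eq_add_one, descPochhammer_succ_coeff_zero,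
    mul_zero]

theorem binomPoly_coeff_one (k : ℕ) :
    (binomPoly k).coeff 1 = (-1 : ℚ) ^ (k - 1) / (k : ℚ) := by
  cases k with
  | zero => simp [binomPoly, Polynomial.coeff_one]
  | succ k =>
    have h : (k.factorial : ℚ) ≠ 0 := by exact_mod_cast k.factorial_ne_zero
    have h2 : (k + 1 : ℚ) ≠ 0 := by positivity
    rw [binomPoly, Polynomial.coeff_C_mul, descPochhammer_succ_coeff_one, Nat.factorial_succ]
    push_cast
    field_simp

/-- If a binomial expansion in `N` is the product of two binomial expansions without constant
term, then the coefficient of `N` in it vanishes. -/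
theorem sum_binomPoly_coeff_one_eq_zero {A : Type*} [Ring A] [Algebra ℚ A] (m : ℕ)
    (a b c : ℕ → A) (hb : b 0 = 0) (hc : c 0 = 0)
    (h : ∀ N : ℕ, ∑ k ∈ range m, (N.choose k : ℚ) • a k =
      (∑ k ∈ range m, (N.choose k : ℚ) • b k) * ∑ k ∈ range m, (N.choose k : ℚ) • c k) :
    ∑ k ∈ range m, ((-1 : ℚ) ^ (k - 1) / (k : ℚ)) • a k = 0 := by
  rw [← Module.forall_dual_apply_eq_zero_iff ℚ]
  intro φ
  have key : ∑ k ∈ range m, binomPoly k * Polynomial.C (φ (a k)) =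
      ∑ k ∈ range m, ∑ l ∈ range m,
        binomPoly k * binomPoly l * Polynomial.C (φ (b k * c l)) := by
    refine Polynomial.eq_of_infinite_eval_eq _ _
      ((Set.infinite_range_of_injective (Nat.cast_injective (R := ℚ))).mono ?_)
    rintro _ ⟨N, rfl⟩
    have hN := congrArg φ (h N)
    simp only [sum_mul_sum, map_sum, map_smul, smul_mul_smul_comm, smul_eq_mul] at hN
    simpa [Polynomial.eval_finsetSum, binomPoly_eval_natCast] using hN
  have key1 := congrArg (fun p => Polynomial.coeff p 1) key
  simp only [Polynomial.finsetSum_coeff, Polynomial.coeff_mul_C, binomPoly_coeff_one] at key1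
  simp only [map_sum, map_smul, smul_eq_mul]
  rw [key1]
  refine sum_eq_zero fun k _ => sum_eq_zero fun l _ => ?_
  rcases eq_or_ne k 0 with rfl | hk
  · simp [hb]
  rcases eq_or_ne l 0 with rfl | hl
  · simp [hc]
  simp [Polynomial.coeff_mul, Finset.Nat.antidiagonal_succ, binomPoly_coeff_zero hk,
    binomPoly_coeff_zero hl]

theorem isOSP_nil {n : ℕ} (E : Block n) : IsOSP E [] ↔ E = ∅ := by
  simp [IsOSP, eq_empty_iff_forall_notMem]

theorem isOSP_cons {n : ℕ} (E P : Block n) (l : List (Block n)) :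
    IsOSP E (P :: l) ↔ P.Nonempty ∧ P ⊆ E ∧ IsOSP (E \ P) l := by
  simp only [IsOSP, List.mem_cons, forall_eq_or_imp, List.pairwise_cons, exists_eq_or_imp,
    subset_sdiff, mem_sdiff]
  constructor
  · rintro ⟨⟨hP, hl⟩, ⟨hd, hp⟩, ⟨hPE, hs⟩, hc⟩
    exact ⟨hP, hPE, hl, hp, fun Q hQ => ⟨hs Q hQ, (hd Q hQ).symm⟩,
      fun i hi => (hc i hi.1).resolve_left hi.2⟩
  · rintro ⟨hP, hPE, hl, hp, hs, hc⟩
    refine ⟨⟨hP, hl⟩, ⟨fun Q hQ => (hs Q hQ).2.symm, hp⟩, ⟨hPE, fun Q hQ => (hs Q hQ).1⟩,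
      fun i hi => ?_⟩
    by_cases h : i ∈ P
    · exact Or.inl h
    · exact Or.inr (hc i ⟨hi, h⟩)

/-- The ordered set partitions of `E` with `k` blocks. -/
def ospFinset {n : ℕ} : ℕ → Block n → Finset (List (Block n))
  | 0, E => if E = ∅ then {[]} else ∅
  | k + 1, E => (E.powerset.erase ∅).biUnion fun P => (ospFinset k (E \ P)).image (List.cons P)

theorem mem_ospFinset {n : ℕ} (k : ℕ) (E : Block n) (l : List (Block n)) :
    l ∈ ospFinset k E ↔ IsOSP E l ∧ l.length = k := by
  induction k generalizing E l with
  | zero =>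
    rw [List.length_eq_zero_iff, ospFinset]
    split_ifs with h
    · simp only [mem_singleton]
      exact ⟨fun hl => ⟨hl ▸ (isOSP_nil E).2 h, hl⟩, fun hl => hl.2⟩
    · simp only [notMem_empty, false_iff]
      rintro ⟨hl, rfl⟩
      exact h ((isOSP_nil E).1 hl)
  | succ k ih =>
    cases l with
    | nil => simp [ospFinset]
    | cons P l =>
      simp [ospFinset, isOSP_cons, ih, nonempty_iff_ne_empty, and_assoc]

theorem ospFinset_eq_empty {n : ℕ} {k : ℕ} {E : Block n} (h : #E < k) : ospFinset k E = ∅ := by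
  induction k generalizing E with
  | zero => omega
  | succ k ih =>
    rw [ospFinset, eq_empty_iff_forall_notMem]
    intro l hl
    obtain ⟨P, hP, hl⟩ := mem_biUnion.1 hl
    rw [mem_erase, mem_powerset] at hP
    have h1 := card_pos.2 (nonempty_iff_ne_empty.2 hP.1)
    have h2 := card_sdiff_add_card_eq_card hP.2
    rw [ih (by omega), image_empty] at hl
    exact notMem_empty l hl

section Sums

variable {A : Type*} [Ring A] {n : ℕ}

/-- The sum of `X_{P₁} ⋯ X_{P_k}` over the ordered set partitions of `E` with `k` blocks. -/
def ospSum (X : Fin n → A) (k : ℕ) (E : Block n) : A :=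
  ∑ l ∈ ospFinset k E, (l.map (blockProd X)).prod

/-- The sum of `X_{P₁} ⋯ X_{P_N}` over the sequences of `N` disjoint, possibly empty blocks
with union `E`. -/
def weakSum (X : Fin n → A) : ℕ → Block n → A
  | 0, E => if E = ∅ then 1 else 0
  | N + 1, E => ∑ P ∈ E.powerset, blockProd X P * weakSum X N (E \ P)

theorem ospSum_zero (X : Fin n → A) (E : Block n) :
    ospSum X 0 E = if E = ∅ then 1 else 0 := by
  unfold ospSum ospFinset
  split_ifs <;> simp

theorem ospSum_succ (X : Fin n → A) (k : ℕ) (E : Block n) :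
    ospSum X (k + 1) E = ∑ P ∈ E.powerset.erase ∅, blockProd X P * ospSum X k (E \ P) := by
  rw [ospSum, ospFinset, sum_biUnion]
  · refine sum_congr rfl fun P _ => ?_
    rw [sum_image (fun _ _ _ _ h => (List.cons.inj h).2), ospSum, mul_sum]
    simp
  · intro P _ Q _ hPQ
    simp only [Function.onFun, disjoint_left, mem_image]
    rintro _ ⟨l, _, rfl⟩ ⟨l', _, h⟩
    exact hPQ (List.cons.inj h).1.symm

theorem ospSum_eq_zero (X : Fin n → A) {k : ℕ} {E : Block n} (h : #E < k) :
    ospSum X k E = 0 := by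
  rw [ospSum, ospFinset_eq_empty h, sum_empty]

theorem blockProd_empty (X : Fin n → A) : blockProd X ∅ = 1 := by
  simp [blockProd]

theorem weakSum_eq_sum_choose [Algebra ℚ A] (X : Fin n → A) (N m : ℕ) (E : Block n)
    (hm : #E < m) :
    weakSum X N E = ∑ k ∈ range m, (N.choose k : ℚ) • ospSum X k E := by
  induction N generalizing E with
  | zero =>
    obtain ⟨m, rfl⟩ := Nat.exists_eq_succ_of_ne_zero (by omega : m ≠ 0)
    rw [sum_range_succ']
    simp [weakSum, ospSum_zero]
  | succ N ih =>
    have hE : weakSum X (N + 1) E = weakSum X N E +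
        ∑ k ∈ range m, (N.choose k : ℚ) • ospSum X (k + 1) E := by
      rw [weakSum, ← add_sum_erase _ _ (empty_mem_powerset E), blockProd_empty, one_mul,
        sdiff_empty]
      congr 1
      simp only [ospSum_succ, smul_sum]
      rw [sum_comm]
      refine sum_congr rfl fun P _ => ?_
      rw [ih _ ((card_le_card sdiff_subset).trans_lt hm), mul_sum]
      simp only [mul_smul_comm]
    rw [hE, ih E hm]
    obtain ⟨m, rfl⟩ := Nat.exists_eq_succ_of_ne_zero (by omega : m ≠ 0)
    rw [sum_range_succ' (fun k => (N.choose k : ℚ) • ospSum X k E),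
      sum_range_succ' (fun k => ((N + 1).choose k : ℚ) • ospSum X k E), sum_range_succ, ospSum_eq_zero X hm,
      smul_zero, add_zero, add_right_comm, ← sum_add_distrib]
    simp only [Nat.choose_succ_succ', Nat.choose_zero_right, Nat.cast_add, add_smul]
    simp only [add_comm]

theorem prod_map_eq_filter_mul_filter (X : Fin n → A) (I : Block n)
    (hcomm : ∀ i ∈ I, ∀ j ∉ I, X i * X j = X j * X i) (l : List (Fin n)) :
    (l.map X).prod =
      ((l.filter (· ∈ I)).map X).prod * ((l.filter (· ∉ I)).map X).prod := by
  induction l with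
  | nil => simp
  | cons a l ih =>
    by_cases ha : a ∈ I
    · simp [ha, ih, mul_assoc]
    · have hc : Commute (X a) ((l.filter (· ∈ I)).map X).prod := by
        refine Commute.list_prod_right _ _ fun x hx => ?_
        obtain ⟨i, hi, rfl⟩ := List.mem_map.1 hx
        exact (hcomm i (by simpa using (List.mem_filter.1 hi).2) a ha).symm
      simp only [List.map_cons, List.prod_cons, ih, ha, decide_false, not_false_eq_true,
        decide_true, Bool.false_eq_true, List.filter_cons_of_neg, List.filter_cons_of_pos]
      rw [← mul_assoc, hc.eq, mul_assoc]

theorem sort_filter (P : Block n) (p : Fin n → Prop) [DecidablePred p] :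
    (P.filter p).sort (· ≤ ·) = (P.sort (· ≤ ·)).filter (fun i => decide (p i)) := by
  refine List.Perm.eq_of_pairwise' (r := (· ≤ ·)) (pairwise_sort _ _)
    ((pairwise_sort _ _).filter _) ?_
  rw [List.perm_ext_iff_of_nodup (sort_nodup _ _) ((sort_nodup _ _).filter _)]
  simp

theorem blockProd_eq_mul (X : Fin n → A) (I : Block n)
    (hcomm : ∀ i ∈ I, ∀ j ∉ I, X i * X j = X j * X i) (P : Block n) :
    blockProd X P = blockProd X (P.filter (· ∈ I)) * blockProd X (P.filter (· ∉ I)) := by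
  simp only [blockProd, sort_filter]
  exact prod_map_eq_filter_mul_filter X I hcomm _

theorem commute_weakSum {X : Fin n → A} {a : A} (N : ℕ) (E : Block n)
    (h : ∀ i ∈ E, Commute a (X i)) : Commute a (weakSum X N E) := by
  induction N generalizing E with
  | zero =>
    rw [weakSum]
    split_ifs
    exacts [Commute.one_right a, Commute.zero_right a]
  | succ N ih =>
    refine Commute.sum_right _ _ _ fun P hP => Commute.mul_right ?_
      (ih _ fun i hi => h i (sdiff_subset hi))
    refine Commute.list_prod_right _ _ fun x hx => ?_
    obtain ⟨i, hi, rfl⟩ := List.mem_map.1 hx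
    exact h i (mem_powerset.1 hP ((mem_sort _).1 hi))

theorem weakSum_union (X : Fin n → A) (I : Block n)
    (hcomm : ∀ i ∈ I, ∀ j ∉ I, X i * X j = X j * X i) (N : ℕ) (E : Block n) :
    weakSum X N E = weakSum X N (E.filter (· ∈ I)) * weakSum X N (E.filter (· ∉ I)) := by
  induction N generalizing E with
  | zero =>
    have hE : E = ∅ ↔ E.filter (· ∈ I) = ∅ ∧ E.filter (· ∉ I) = ∅ := by
      rw [← union_eq_empty, filter_union_filter_not_eq]
    simp only [weakSum, hE, ite_and, ite_mul, one_mul, zero_mul]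
  | succ N ih =>
    simp only [weakSum]
    rw [sum_mul_sum, ← sum_product']
    refine sum_bij' (fun P _ => (P.filter (· ∈ I), P.filter (· ∉ I))) (fun Q _ => Q.1 ∪ Q.2)
      ?_ ?_ ?_ ?_ ?_
    · intro P hP
      rw [mem_powerset] at hP
      simp only [mem_product, mem_powerset]
      exact ⟨filter_subset_filter _ hP, filter_subset_filter _ hP⟩
    · rintro ⟨Q, R⟩ hQ
      simp only [mem_product, mem_powerset] at hQ ⊢
      exact union_subset (hQ.1.trans (filter_subset _ _)) (hQ.2.trans (filter_subset _ _))
    · intro P _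
      exact filter_union_filter_not_eq _ _
    · rintro ⟨Q, R⟩ hQ
      simp only [mem_product, mem_powerset, subset_iff, mem_filter] at hQ
      ext i <;> simp only [mem_filter, mem_union] <;> grind
    · intro P _
      have h1 : (E \ P).filter (· ∈ I) = E.filter (· ∈ I) \ P.filter (· ∈ I) := by
        ext; simp only [mem_filter, mem_sdiff]; tauto
      have h2 : (E \ P).filter (· ∉ I) = E.filter (· ∉ I) \ P.filter (· ∉ I) := by
        ext; simp only [mem_filter, mem_sdiff]; tauto
      have hc : Commute (blockProd X (P.filter (· ∉ I)))
          (weakSum X N (E.filter (· ∈ I) \ P.filter (· ∈ I))) := by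
        refine commute_weakSum _ _ fun i hi => Commute.list_prod_left _ _ fun x hx => ?_
        obtain ⟨j, hj, rfl⟩ := List.mem_map.1 hx
        exact (hcomm i (mem_filter.1 (mem_sdiff.1 hi).1).2 j
          (mem_filter.1 ((mem_sort _).1 hj)).2).symm
      rw [ih, blockProd_eq_mul X I hcomm, h1, h2, mul_assoc, ← mul_assoc (blockProd X _)
        (weakSum X N _), hc.eq]
      simp only [mul_assoc]

end Sums

theorem finsum_isOSP {A : Type*} [Ring A] [Algebra ℚ A] {n : ℕ} (X : Fin n → A) (w : ℕ → ℚ) :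
    (∑ᶠ π ∈ {π : List (Block n) | IsOSP Finset.univ π},
      w π.length • (π.map (blockProd X)).prod) =
    ∑ k ∈ range (n + 1), w k • ospSum X k Finset.univ := by
  have hset : {π : List (Block n) | IsOSP Finset.univ π} =
      ((range (n + 1)).biUnion fun k => ospFinset k (Finset.univ : Block n)) := by
    ext l
    simp only [Set.mem_ofPred_eq, coe_biUnion, Set.mem_iUnion, mem_coe]
    refine ⟨fun h => ?_, fun ⟨k, _, hl⟩ => ((mem_ospFinset k _ l).1 hl).1⟩
    have hl := (mem_ospFinset l.length _ l).2 ⟨h, rfl⟩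
    refine ⟨l.length, ?_, hl⟩
    by_contra hlen
    rw [ospFinset_eq_empty (by simpa [Nat.lt_succ_iff] using hlen)] at hl
    exact notMem_empty l hl
  rw [hset, finsum_mem_coe_finset, sum_biUnion]
  · refine sum_congr rfl fun k _ => ?_
    rw [ospSum, smul_sum]
    exact sum_congr rfl fun l hl => by rw [((mem_ospFinset k _ l).1 hl).2]
  · intro j _ k _ hjk
    simp only [Function.onFun, disjoint_left, mem_ospFinset]
    rintro l ⟨_, rfl⟩ ⟨_, h⟩
    exact hjk h

/-- Let `A` be a unital associative `ℚ`-algebra, `n ≥ 2`, `X₁,…,Xₙ ∈ A`, and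
suppose there is `I ⊆ [n]` with `∅ ≠ I ≠ [n]` such that `X_i X_j = X_j X_i` for all `i ∈ I`,
`j ∈ [n]∖I`. Then `∑_{π ∈ OP_n} ((−1)^{|π|−1}/|π|) X_{P₁} X_{P₂} ⋯ X_{P_{|π|}} = 0`:
the NCT cumulant `K_n^{NCT}(X₁,…,Xₙ)` vanishes whenever the arguments split into two mutually
commuting families. -/
theorem statement18 {A : Type*} [Ring A] [Algebra ℚ A] {n : ℕ} (hn : 2 ≤ n)
    (X : Fin n → A) (I : Finset (Fin n)) (hI : I.Nonempty) (hIc : I ≠ Finset.univ)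
    (hcomm : ∀ i ∈ I, ∀ j ∉ I, X i * X j = X j * X i) :
    (∑ᶠ π ∈ {π : List (Block n) | IsOSP Finset.univ π},
      ((-1 : ℚ) ^ (π.length - 1) / (π.length : ℚ)) • (π.map (blockProd X)).prod) = 0 := by
  rw [finsum_isOSP X fun k => (-1 : ℚ) ^ (k - 1) / (k : ℚ)]
  have hcard (p : Fin n → Prop) [DecidablePred p] : #(Finset.univ.filter p) < n + 1 :=
    Nat.lt_succ_iff.2 ((card_le_univ _).trans_eq (Fintype.card_fin n))
  refine sum_binomPoly_coeff_one_eq_zero (n + 1) _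
    (fun k => ospSum X k (Finset.univ.filter (· ∈ I)))
    (fun k => ospSum X k (Finset.univ.filter (· ∉ I))) ?_ ?_ fun N => ?_
  · obtain ⟨i, hi⟩ := hI
    exact (ospSum_zero X _).trans (if_neg (ne_empty_of_mem (mem_filter.2 ⟨mem_univ i, hi⟩)))
  · obtain ⟨j, hj⟩ : ∃ j, j ∉ I := by simpa [eq_univ_iff_forall] using hIc
    exact (ospSum_zero X _).trans (if_neg (ne_empty_of_mem (mem_filter.2 ⟨mem_univ j, hj⟩)))
  · rw [← weakSum_eq_sum_choose X N _ _ (by simp), ← weakSum_eq_sum_choose X N _ _ (hcard _),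
      ← weakSum_eq_sum_choose X N _ _ (hcard _)]
    exact weakSum_union X I hcomm N _

end OSPpaper
end

section
/- Let A be the free associative unital ℚ-algebra on a set 𝔄 of generators. For k ≥ 1 let δ_k : A → A^{⊗k} be the unique algebra homomorphism with δ_k(a) = ∑_{j=1}^{k} 1^{⊗(j−1)} ⊗ a ⊗ 1^{⊗(k−j)} for every generator a ∈ 𝔄, let ε : A → A be the algebra endomorphism sending every generator to 0 (so ε fixes the unit and annihilates all words of positive length), and let conc_k : A^{⊗k} → A be the k-fold multiplication map. Then for every n ≥ 1 and all generators a_1,…,a_n ∈ 𝔄 (not necessarily distinct), ∑_{k=1}^{n} ((−1)^{k−1}/k) · conc_k( (Id−ε)^{⊗k} ( δ_k(a_1 a_2 ⋯ a_n) ) ) = ∑_{π ∈ OP_n} ((−1)^{|π|−1}/|π|) · a_{P_1} a_{P_2} ⋯ a_{P_{|π|}}, where for π = (P_1,…,P_{|π|}) and P ⊆ [n], a_P denotes the product of the a_i with i ∈ P taken in increasing order of i. (This identifies the Lie projector Π = ∑_{k≥1} ((−1)^{k−1}/k)(Id−ε)^{∗k}, whose terms with k > n vanish on words of length n, with the ordered-set-partition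 cumulant on words.) -/
open Finset

namespace OSPpaper

/-- The coproduct `δ_k : A → A^{⊗k}`: the unique algebra homomorphism with
`δ_k(a) = ∑_{j=1}^k 1^{⊗(j−1)} ⊗ a ⊗ 1^{⊗(k−j)}` on generators. -/
noncomputable def deltaMap (α : Type*) (k : ℕ) :
    FreeAlgebra ℚ α →ₐ[ℚ] PiTensorProduct ℚ (fun _ : Fin k => FreeAlgebra ℚ α) :=
  FreeAlgebra.lift ℚ (fun x => ∑ j : Fin k,
    PiTensorProduct.tprod ℚ (fun i => if i = j then FreeAlgebra.ι ℚ x else 1))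

/-- The algebra endomorphism `ε` of the free algebra sending every generator to `0`. -/
noncomputable def epsMap (α : Type*) : FreeAlgebra ℚ α →ₐ[ℚ] FreeAlgebra ℚ α :=
  FreeAlgebra.lift ℚ (fun _ => 0)

/-- The `k`-fold multiplication map `conc_k : A^{⊗k} → A`. -/
noncomputable def concMap (α : Type*) (k : ℕ) :
    PiTensorProduct ℚ (fun _ : Fin k => FreeAlgebra ℚ α) →ₗ[ℚ] FreeAlgebra ℚ α :=
  PiTensorProduct.lift (MultilinearMap.mkPiAlgebraFin ℚ k (FreeAlgebra ℚ α))

/-- The `i`-th level set of `f`. -/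
def fiber {n k : ℕ} (f : Fin n → Fin k) (i : Fin k) : Block n :=
  Finset.univ.filter (fun j => f j = i)

theorem mem_fiber {n k : ℕ} {f : Fin n → Fin k} {i : Fin k} {j : Fin n} :
    j ∈ fiber f i ↔ f j = i := by
  simp [fiber]

theorem sort_eq_filter_finRange {n : ℕ} (P : Block n) :
    P.sort (· ≤ ·) = (List.finRange n).filter (fun j => decide (j ∈ P)) := by
  refine List.Perm.eq_of_pairwise' (r := (· ≤ ·)) (P.pairwise_sort (· ≤ ·))
    ((List.pairwise_le_finRange n).filter _) ?_
  refine (List.perm_ext_iff_of_nodup (P.sort_nodup (· ≤ ·)) ((List.nodup_finRange n).filter _)).2 ?_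
  simp

theorem blockProd_eq_prod_ofFn {n : ℕ} {A : Type*} [Monoid A] (X : Fin n → A) (P : Block n) :
    blockProd X P = (List.ofFn (fun j => if j ∈ P then X j else 1)).prod := by
  rw [blockProd, sort_eq_filter_finRange, List.ofFn_eq_map]
  induction List.finRange n with
  | nil => simp
  | cons j l ih => by_cases h : j ∈ P <;> simp [h, ih]

theorem prod_ofFn_sum {R A ι : Type*} [CommSemiring R] [Semiring A] [Algebra R A] [Fintype ι]
    {n : ℕ} (g : Fin n → ι → A) :
    (List.ofFn (fun j => ∑ i, g j i)).prod =
      ∑ f : Fin n → ι, (List.ofFn (fun j => g j (f j))).prod := by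
  classical
  simpa using (MultilinearMap.mkPiAlgebraFin R n A).map_sum g

theorem deltaMap_prod_ofFn {α : Type*} {n : ℕ} (a : Fin n → α) (k : ℕ) :
    deltaMap α k ((List.ofFn (fun j => FreeAlgebra.ι ℚ (a j))).prod) =
      ∑ f : Fin n → Fin k, PiTensorProduct.tprod ℚ
        (fun i => blockProd (fun j => FreeAlgebra.ι ℚ (a j)) (fiber f i)) := by
  rw [map_list_prod, List.map_ofFn]
  have h : (deltaMap α k ∘ fun j => FreeAlgebra.ι ℚ (a j)) = fun j => ∑ l : Fin k,
      PiTensorProduct.tprod ℚ (fun i => if i = l then FreeAlgebra.ι ℚ (a j) else 1) := by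
    funext j
    simp [deltaMap]
  rw [h, prod_ofFn_sum (R := ℚ)]
  refine Finset.sum_congr rfl fun f _ => ?_
  simp only [← PiTensorProduct.tprodMonoidHom_apply (R := ℚ)]
  rw [← Function.comp_def (PiTensorProduct.tprodMonoidHom ℚ), ← List.map_ofFn, ← map_list_prod]
  congr 1
  funext i
  rw [Pi.list_prod_apply, List.map_ofFn, blockProd_eq_prod_ofFn]
  simp [Function.comp_def, mem_fiber, eq_comm]

theorem epsMap_blockProd {α : Type*} {n : ℕ} (a : Fin n → α) (P : Block n) :
    epsMap α (blockProd (fun j => FreeAlgebra.ι ℚ (a j)) P) = if P.Nonempty then 0 else 1 := by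
  rw [blockProd, map_list_prod, List.map_map]
  split_ifs with h
  · obtain ⟨j, hj⟩ := h
    refine List.prod_eq_zero (List.mem_map.2 ⟨j, by simpa using hj, ?_⟩)
    simp [epsMap]
  · simp [Finset.not_nonempty_iff_eq_empty.1 h]

theorem id_sub_epsMap_blockProd {α : Type*} {n : ℕ} (a : Fin n → α) (P : Block n) :
    (LinearMap.id - (epsMap α).toLinearMap : FreeAlgebra ℚ α →ₗ[ℚ] FreeAlgebra ℚ α)
        (blockProd (fun j => FreeAlgebra.ι ℚ (a j)) P) =
      if P.Nonempty then blockProd (fun j => FreeAlgebra.ι ℚ (a j)) P else 0 := by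
  rw [LinearMap.sub_apply, AlgHom.toLinearMap_apply, epsMap_blockProd]
  split_ifs with h
  · simp
  · simp [Finset.not_nonempty_iff_eq_empty.1 h, blockProd]

theorem fiber_nonempty_iff_surjective {n k : ℕ} {f : Fin n → Fin k} :
    (∀ i, (fiber f i).Nonempty) ↔ Function.Surjective f := by
  simp [Function.Surjective, Finset.Nonempty, mem_fiber]

open Classical in
/-- The `k`-th convolution power of `Id - ε` on a word is a sum over surjections onto `Fin k`. -/
theorem concMap_map_deltaMap {α : Type*} {n : ℕ} (a : Fin n → α) (k : ℕ) :
    concMap α k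
        ((PiTensorProduct.map (fun _ : Fin k => (LinearMap.id - (epsMap α).toLinearMap)))
          (deltaMap α k ((List.ofFn (fun j => FreeAlgebra.ι ℚ (a j))).prod))) =
      ∑ f : Fin n → Fin k with Function.Surjective f,
        ((List.ofFn (fiber f)).map (blockProd (fun j => FreeAlgebra.ι ℚ (a j)))).prod := by
  rw [deltaMap_prod_ofFn, map_sum, map_sum, Finset.sum_filter]
  refine Finset.sum_congr rfl fun f _ => ?_
  rw [PiTensorProduct.map_tprod, concMap, PiTensorProduct.lift.tprod,
    MultilinearMap.mkPiAlgebraFin_apply]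
  simp only [id_sub_epsMap_blockProd]
  split_ifs with h
  · simp [fiber_nonempty_iff_surjective.2 h, List.map_ofFn, Function.comp_def]
  · rw [← fiber_nonempty_iff_surjective] at h
    push Not at h
    obtain ⟨i, hi⟩ := h
    exact List.prod_eq_zero ((List.mem_ofFn' _ _).2 ⟨i, by simp [hi]⟩)

theorem isOSP_ofFn_fiber {n k : ℕ} {f : Fin n → Fin k} (hf : Function.Surjective f) :
    IsOSP Finset.univ (List.ofFn (fiber f)) := by
  refine ⟨?_, ?_, fun _ _ => Finset.subset_univ _, fun j _ =>
    ⟨fiber f (f j), (List.mem_ofFn' _ _).2 ⟨_, rfl⟩, mem_fiber.2 rfl⟩⟩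
  · intro P hP
    obtain ⟨i, rfl⟩ := (List.mem_ofFn' _ _).1 hP
    exact fiber_nonempty_iff_surjective.2 hf i
  · rw [List.pairwise_ofFn]
    intro i i' hlt
    rw [Finset.disjoint_left]
    intro j hj hj'
    exact hlt.ne ((mem_fiber.1 hj).symm.trans (mem_fiber.1 hj'))

theorem IsOSP.exists_surjective {n : ℕ} {l : List (Block n)} (hl : IsOSP Finset.univ l) :
    ∃ f : Fin n → Fin l.length, Function.Surjective f ∧ List.ofFn (fiber f) = l := by
  obtain ⟨hne, hdisj, -, hcov⟩ := hl
  have hidx : ∀ j, ∃ i : Fin l.length, j ∈ l.get i := fun j => by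
    obtain ⟨P, hP, hj⟩ := hcov j (Finset.mem_univ j)
    obtain ⟨i, rfl⟩ := List.mem_iff_get.1 hP
    exact ⟨i, hj⟩
  choose f hf using hidx
  have huniq : ∀ i j, j ∈ l.get i → f j = i := by
    intro i j hj
    by_contra hij
    rw [List.pairwise_iff_get] at hdisj
    rcases lt_or_gt_of_ne hij with h | h
    · exact Finset.disjoint_left.1 (hdisj _ _ h) (hf j) hj
    · exact Finset.disjoint_left.1 (hdisj _ _ h) hj (hf j)
  have hfib : fiber f = l.get := by
    funext i
    ext j
    rw [mem_fiber]
    exact ⟨fun h => h ▸ hf j, huniq i j⟩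
  refine ⟨f, fiber_nonempty_iff_surjective.1 fun i => ?_, by rw [hfib, List.ofFn_get]⟩
  rw [hfib]
  exact hne _ (List.get_mem l i)

theorem ofFn_fiber_injective {n : ℕ} :
    Function.Injective
      (fun p : (k : ℕ) × (Fin n → Fin k) => List.ofFn (fiber p.2)) := by
  rintro ⟨k, f⟩ ⟨k', f'⟩ h
  obtain rfl : k = k' := by simpa using congrArg List.length h
  have hfib : fiber f = fiber f' := List.ofFn_injective h
  obtain rfl : f = f' := by
    funext j
    exact (mem_fiber.1 (hfib ▸ mem_fiber.2 rfl : j ∈ fiber f' (f j))).symm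
  rfl

open Classical in
theorem setOf_isOSP_univ {n : ℕ} (hn : 1 ≤ n) :
    {l : List (Block n) | IsOSP Finset.univ l} =
      (((Finset.Icc 1 n).sigma
          (fun k => {f : Fin n → Fin k | Function.Surjective f})).image
        (fun p => List.ofFn (fiber p.2)) : Finset (List (Block n))) := by
  ext l
  simp only [Set.mem_ofPred_eq, Finset.coe_image, Set.mem_image, Finset.mem_coe, Finset.mem_sigma,
    Finset.mem_Icc, Finset.mem_filter, Finset.mem_univ, true_and]
  constructor
  · intro hl
    obtain ⟨f, hf, hfl⟩ := hl.exists_surjective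
    refine ⟨⟨l.length, f⟩, ⟨⟨?_, ?_⟩, hf⟩, hfl⟩
    · exact (Nat.zero_le _).trans_lt (f ⟨0, hn⟩).isLt
    · simpa using Fintype.card_le_of_surjective f hf
  · rintro ⟨⟨k, f⟩, ⟨-, hf⟩, rfl⟩
    exact isOSP_ofFn_fiber hf

/-- Let `A` be the free associative unital `ℚ`-algebra on `𝔄`. For all `n ≥ 1`
and generators `a₁,…,aₙ ∈ 𝔄`,
`∑_{k=1}^n ((−1)^{k−1}/k) · conc_k((Id−ε)^{⊗k}(δ_k(a₁⋯aₙ)))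
  = ∑_{π ∈ OP_n} ((−1)^{|π|−1}/|π|) a_{P₁} ⋯ a_{P_{|π|}}`:
the Lie projector `Π = ∑ ((−1)^{k−1}/k)(Id−ε)^{∗k}` agrees on words with the
ordered-set-partition cumulant. -/
theorem statement19 {α : Type*} {n : ℕ} (hn : 1 ≤ n) (a : Fin n → α) :
    (∑ k ∈ Finset.Icc 1 n, ((-1 : ℚ) ^ (k - 1) / (k : ℚ)) •
        concMap α k
          ((PiTensorProduct.map
              (fun _ : Fin k => (LinearMap.id - (epsMap α).toLinearMap)))
            (deltaMap α k ((List.ofFn (fun j => FreeAlgebra.ι ℚ (a j))).prod))))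
    = ∑ᶠ π ∈ {π : List (Block n) | IsOSP Finset.univ π},
        ((-1 : ℚ) ^ (π.length - 1) / (π.length : ℚ)) •
          (π.map (blockProd (fun j => FreeAlgebra.ι ℚ (a j)))).prod := by
  classical
  rw [setOf_isOSP_univ hn, finsum_mem_coe_finset, Finset.sum_image ofFn_fiber_injective.injOn,
    Finset.sum_sigma]
  refine Finset.sum_congr rfl fun k _ => ?_
  rw [concMap_map_deltaMap, Finset.smul_sum]
  simp only [List.length_ofFn]

end OSPpaper
end
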